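/- Let h₀, h₁, …, h_l ∈ ℝ[x₁,…,x_n] be polynomials of degree at most d, with d ≥ 2, and set h̄ = (h₀, h₁,…,h_l). Then the image h₀(V(h̄_KKT)) ⊆ ℝ (the set of values of h₀ at the x-components of points of the KKT variety) is finite, of cardinality at most c(n+l, d+1, n+l). -/

import Mathlib

open MvPolynomial

/-- The bound `c(n,d,s) = d(2d-1)^(n+s-1)` on the number of semi-algebraically
path connected components (Coste). -/
def cFun (n d s : ℕ) : ℕ := d * (2 * d - 1) ^ (n + s - 1)

/-- The KKT variety `V(h̄_KKT) ⊆ ℝⁿ × ℝˡ` associated with `h̄ = (h₀, h₁,…,h_l)`: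
pairs `(x, λ)` with `h_j(x) = 0` for all `j` and `∇h₀(x) = Σ_j λ_j ∇h_j(x)`. -/
def KKTset {n l : ℕ} (h₀ : MvPolynomial (Fin n) ℝ)
    (h : Fin l → MvPolynomial (Fin n) ℝ) : Set ((Fin n → ℝ) × (Fin l → ℝ)) :=
  {p | (∀ j, eval p.1 (h j) = 0) ∧
       ∀ i, eval p.1 (pderiv i h₀) = ∑ j, p.2 j * eval p.1 (pderiv i (h j))}

theorem crit_lift {R κ B : Type*} [CommRing R] [Field κ] [CommRing B] [Algebra R κ] [Algebra R B]
    [Algebra.FormallySmooth R κ] (g : B →ₐ[R] κ) (hg : Function.Surjective g)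
    (hk : ∀ a b, g a = 0 → g b = 0 → a * b = 0) :
    ∃ s : κ →ₐ[R] B, g.comp s = AlgHom.id R κ := by
  have hn : IsNilpotent (RingHom.ker (g : B →+* κ)) := by
    refine ⟨2, ?_⟩
    rw [pow_two, Ideal.zero_eq_bot, eq_bot_iff, Ideal.mul_le]
    intro a ha b hb
    rw [Ideal.mem_bot]
    exact hk a b ha hb
  exact ⟨Algebra.FormallySmooth.liftOfSurjective (AlgHom.id R κ) g hg hn,
    Algebra.FormallySmooth.comp_liftOfSurjective _ _ _ _⟩

theorem crit_smooth {κ : Type*} [Field κ] [Algebra ℝ κ] [Algebra.EssFiniteType ℝ κ]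
    [Algebra (Polynomial ℝ) κ] [IsScalarTower ℝ (Polynomial ℝ) κ]
    [FaithfulSMul (Polynomial ℝ) κ] :
    Algebra.FormallySmooth (Polynomial ℝ) κ := by
  let := FractionRing.liftAlgebra (R := Polynomial ℝ) (K := κ)
  have : IsScalarTower (Polynomial ℝ) (FractionRing (Polynomial ℝ)) κ :=
    FractionRing.isScalarTower_liftAlgebra _ _
  have : IsScalarTower ℝ (FractionRing (Polynomial ℝ)) κ := IsScalarTower.to₁₃₄ _ (Polynomial ℝ) _ _
  have : Algebra.EssFiniteType (FractionRing (Polynomial ℝ)) κ := Algebra.EssFiniteType.of_comp ℝ _ _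
  have : CharZero (FractionRing (Polynomial ℝ)) := charZero_of_injective_algebraMap (R := ℝ) (algebraMap ℝ _).injective
  have : Algebra.FormallySmooth (FractionRing (Polynomial ℝ)) κ := inferInstance
  have : Algebra.FormallySmooth (Polynomial ℝ) (FractionRing (Polynomial ℝ)) :=
    .of_isLocalization (nonZeroDivisors _)
  exact .comp _ (FractionRing (Polynomial ℝ)) _

theorem crit_ring_lift {R κ B : Type*} [CommRing R] [Field κ] [CommRing B] (φ : R →+* κ)
    (hφ : φ.FormallySmooth) (ψ : R →+* B) (g : B →+* κ) (hg : Function.Surjective g)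
    (hk : ∀ a b, g a = 0 → g b = 0 → a * b = 0) (h : ∀ r, g (ψ r) = φ r) :
    ∃ s : κ →+* B, (∀ x, g (s x) = x) ∧ ∀ r, s (φ r) = ψ r := by
  let := φ.toAlgebra
  let := ψ.toAlgebra
  have : Algebra.FormallySmooth R κ := hφ
  obtain ⟨s, hs⟩ := crit_lift (R := R) (⟨g, h⟩ : B →ₐ[R] κ) hg hk
  exact ⟨s.toRingHom, fun x => DFunLike.congr_fun hs x, fun r => s.commutes r⟩

theorem crit_deriv {κ : Type*} [Field κ] [Algebra ℝ κ] [Algebra.EssFiniteType ℝ κ]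
    (t : κ) (ht : Transcendental ℝ t) :
    ∃ s : κ →+* TrivSqZeroExt κ κ, (∀ x, (s x).fst = x) ∧
      (∀ r : ℝ, (s (algebraMap ℝ κ r)).snd = 0) ∧ (s t).snd = 1 := by
  have hφ : (Polynomial.aeval t : Polynomial ℝ →ₐ[ℝ] κ).toRingHom.FormallySmooth := by
    let := (Polynomial.aeval t : Polynomial ℝ →ₐ[ℝ] κ).toRingHom.toAlgebra
    have : IsScalarTower ℝ (Polynomial ℝ) κ := .of_algebraMap_eq fun r =>
      ((Polynomial.aeval t : Polynomial ℝ →ₐ[ℝ] κ).commutes r).symm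
    have : FaithfulSMul (Polynomial ℝ) κ := (faithfulSMul_iff_algebraMap_injective _ _).2
      (transcendental_iff_injective.1 ht)
    exact crit_smooth
  obtain ⟨s, h1, h2⟩ := crit_ring_lift _ hφ
    (Polynomial.aeval (TrivSqZeroExt.inl t + TrivSqZeroExt.inr 1) :
      Polynomial ℝ →ₐ[ℝ] TrivSqZeroExt κ κ).toRingHom
    (TrivSqZeroExt.fstHom ℝ κ κ).toRingHom (fun x => ⟨TrivSqZeroExt.inl x, rfl⟩)
    (fun a b ha hb => by
      have ha : a.fst = 0 := ha
      have hb : b.fst = 0 := hb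
      ext <;> simp [ha, hb])
    (fun r => by
      change (TrivSqZeroExt.fstHom ℝ κ κ) (Polynomial.aeval _ r) = Polynomial.aeval t r
      rw [← Polynomial.aeval_algHom_apply]
      simp)
  refine ⟨s, h1, fun r => ?_, ?_⟩
  · have := h2 (Polynomial.C r)
    simp at this
    rw [this]; simp [TrivSqZeroExt.algebraMap_eq_inl']
  · have := h2 Polynomial.X
    simp at this
    rw [this]; simp

theorem crit_key {σ κ : Type*} [Fintype σ] [Field κ] (π : MvPolynomial σ ℝ →+* κ)
    (s : κ →+* TrivSqZeroExt κ κ) (h1 : ∀ x, (s x).fst = x) (h2 : ∀ r : ℝ, (s (π (C r))).snd = 0)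
    (p : MvPolynomial σ ℝ) :
    (s (π p)).snd = ∑ i, π (pderiv i p) * (s (π (X i))).snd := by
  induction p using MvPolynomial.induction_on with
  | C a => simp [h2]
  | add p q hp hq => simp [hp, hq, add_mul, Finset.sum_add_distrib]
  | mul_X p j hp =>
    classical
    simp only [map_mul, TrivSqZeroExt.snd_mul, h1, hp, Derivation.leibniz, pderiv_X, map_add,
      smul_eq_mul, op_smul_eq_mul, add_mul, Finset.sum_add_distrib]
    congr 1
    · rw [Finset.sum_eq_single j]
      · simp
      · intro b _ hb; simp [Pi.single_apply, hb.symm]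
      · simp
    · rw [Finset.sum_mul]; exact Finset.sum_congr rfl fun i _ => by ring

theorem crit_alg {σ : Type*} [Fintype σ] (f : MvPolynomial σ ℝ)
    (P : Ideal (MvPolynomial σ ℝ)) [P.IsPrime] (hP : ∀ i, pderiv i f ∈ P) :
    ∃ q : Polynomial ℝ, q ≠ 0 ∧ Polynomial.aeval f q ∈ P := by
  let A := MvPolynomial σ ℝ ⧸ P
  let κ := FractionRing A
  let π : MvPolynomial σ ℝ →ₐ[ℝ] κ := (IsScalarTower.toAlgHom ℝ A κ).comp (Ideal.Quotient.mkₐ ℝ P)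
  have hπ : ∀ p, π p = 0 ↔ p ∈ P := by
    intro p
    change algebraMap A κ (Ideal.Quotient.mk P p) = 0 ↔ _
    rw [FaithfulSMul.algebraMap_eq_zero_iff, Ideal.Quotient.eq_zero_iff_mem]
  by_cases ht : Transcendental ℝ (π f)
  · exfalso
    obtain ⟨s, h1, h2, h3⟩ := crit_deriv (π f) ht
    have key := crit_key π.toRingHom s h1 (fun r => by
      have : π (C r) = algebraMap ℝ κ r := π.commutes r
      exact (congrArg (fun z => (s z).snd) this).trans (h2 r))
    have := (h3.symm.trans (key f)).trans (Finset.sum_eq_zero ?_)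
    · exact one_ne_zero this
    · intro i _
      have h0 : π.toRingHom (pderiv i f) = 0 := (hπ _).2 (hP i)
      rw [h0, zero_mul]
  · rw [Transcendental, not_not] at ht
    obtain ⟨q, hq, hq'⟩ := ht
    refine ⟨q, hq, ?_⟩
    rw [← hπ, ← Polynomial.aeval_algHom_apply, hq']

theorem crit_finite {σ : Type*} [Fintype σ] (f : MvPolynomial σ ℝ) :
    ((fun x => eval x f) '' {x | ∀ i, eval x (pderiv i f) = 0}).Finite := by
  let I : Ideal (MvPolynomial σ ℝ) := Ideal.span (Set.range fun i => pderiv i f)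
  have hI := Ideal.finite_minimalPrimes_of_isNoetherianRing _ I
  have h : ∀ P ∈ I.minimalPrimes, ∃ q : Polynomial ℝ, q ≠ 0 ∧ Polynomial.aeval f q ∈ P := by
    intro P hP
    have := hP.1.1
    exact crit_alg f P fun i => hP.1.2 (Ideal.subset_span ⟨i, rfl⟩)
  choose! q hq hq' using h
  refine (hI.biUnion fun P hP => (q P).rootSet_finite ℝ).subset ?_
  rintro _ ⟨x, hx, rfl⟩
  have hIx : I ≤ RingHom.ker (eval x) := by
    rw [Ideal.span_le]
    rintro _ ⟨i, rfl⟩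
    exact hx i
  have : (RingHom.ker (eval x : MvPolynomial σ ℝ →+* ℝ)).IsPrime := RingHom.ker_isPrime _
  obtain ⟨P, hP, hle⟩ := Ideal.exists_minimalPrimes_le hIx
  rw [Set.mem_iUnion₂]
  refine ⟨P, hP, ?_⟩
  rw [Polynomial.mem_rootSet]
  refine ⟨hq P hP, ?_⟩
  have h0 : eval x (Polynomial.aeval f (q P)) = 0 := hle (hq' P hP)
  have h1 : aeval x (Polynomial.aeval f (q P)) = 0 := by rw [← h0]; simp [aeval_eq_eval]
  rw [← Polynomial.aeval_algHom_apply] at h1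
  simpa [aeval_eq_eval] using h1

theorem crit_pderiv_deg {σ : Type*} (f : MvPolynomial σ ℝ) (i : σ) :
    (pderiv i f).totalDegree ≤ f.totalDegree - 1 := by
  classical
  conv_lhs => rw [f.as_sum, map_sum]
  refine totalDegree_finsetSum_le fun a ha => ?_
  rw [pderiv_monomial]
  by_cases h : a i = 0
  · simp [h]
  refine (totalDegree_monomial_le _ _).trans ?_
  have h1 := le_totalDegree ha
  have ha' : a = (a - Finsupp.single i 1) + Finsupp.single i 1 := by
    rw [tsub_add_cancel_of_le]
    exact Finsupp.single_le_iff.2 (by omega)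
  have hsum : (a.sum fun _ e => e) = ((a - Finsupp.single i 1).sum fun _ e => e) + 1 := by
    conv_lhs => rw [ha']
    rw [Finsupp.sum_add_index' (by simp) (by simp), Finsupp.sum_single_index rfl]
  change ((a - Finsupp.single i 1).sum fun _ e => e) ≤ _
  omega

theorem crit_hasDeriv {σ : Type*} [Fintype σ] [DecidableEq σ] (f : MvPolynomial σ ℝ) (i : σ) (x : σ → ℝ) :
    HasDerivAt (fun t => eval (Function.update x i t) f) (eval x (pderiv i f)) (x i) := by
  induction f using MvPolynomial.induction_on with
  | C a => simpa using hasDerivAt_const _ _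
  | add p q hp hq => simp only [map_add]; exact hp.add hq
  | mul_X p j hp =>
    have hX : HasDerivAt (fun t => Function.update x i t j) ((Pi.single i (1:ℝ) : σ → ℝ) j) (x i) := by
      by_cases h : j = i
      · subst h; simpa using hasDerivAt_id' _
      · simpa [h] using hasDerivAt_const _ _
    have := hp.mul hX
    simp only [map_mul, eval_X, Derivation.leibniz, smul_eq_mul, map_add, pderiv_X]
    have e : eval x p * eval x ((Pi.single i 1 : σ → MvPolynomial σ ℝ) j) + x j * eval x (pderiv i p) =
        eval x (pderiv i p) * Function.update x i (x i) j +
          eval (Function.update x i (x i)) p * (Pi.single i (1:ℝ) : σ → ℝ) j := by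
      by_cases h : j = i
      · subst h; simp; ring
      · simp [h]; ring
    rw [e]
    exact this

open Classical in
theorem crit_interp {σ : Type*} (S : Finset (σ → ℝ)) (x : S) :
    ∃ p : MvPolynomial σ ℝ, ∀ y : S, eval y.1 p = if y = x then 1 else 0 := by
  classical
  have h : ∀ y : S, ∃ p : MvPolynomial σ ℝ, y ≠ x → eval x.1 p = 1 ∧ eval y.1 p = 0 := by
    intro y
    by_cases hy : y = x
    · exact ⟨0, fun h => absurd hy h⟩
    · have : ∃ i, x.1 i ≠ y.1 i := by
        by_contra! hc
        exact hy (Subtype.ext (funext hc).symm)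
      obtain ⟨i, hi⟩ := this
      refine ⟨C (x.1 i - y.1 i)⁻¹ * (X i - C (y.1 i)), fun _ => ?_⟩
      simp [inv_mul_cancel₀ (sub_ne_zero.2 hi)]
  choose p hp using h
  refine ⟨∏ y ∈ Finset.univ.erase x, p y, fun y => ?_⟩
  rw [map_prod]
  split_ifs with hy
  · subst hy
    exact Finset.prod_eq_one fun z hz => (hp z (Finset.ne_of_mem_erase hz)).1
  · exact Finset.prod_eq_zero (Finset.mem_erase.2 ⟨hy, Finset.mem_univ _⟩) (hp y hy).2

theorem crit_count {σ : Type*} [Fintype σ] (m : ℕ) (q : σ → MvPolynomial σ ℝ)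
    (hq : ∀ i, (q i).totalDegree < m) (S : Finset (σ → ℝ))
    (hS : ∀ x ∈ S, ∀ i, x i ^ m = eval x (q i)) : S.card ≤ m ^ Fintype.card σ := by
  classical
  let ev : MvPolynomial σ ℝ →ₗ[ℝ] (S → ℝ) := LinearMap.pi fun x => (aeval x.1).toLinearMap
  have hev : ∀ p x, ev p x = eval x.1 p := fun p x => by simp [ev, aeval_eq_eval]
  let b : (σ → Fin m) → (S → ℝ) := fun a x => ∏ i, x.1 i ^ (a i : ℕ)
  have hspan : ∀ n, ∀ p : MvPolynomial σ ℝ, p.totalDegree ≤ n → ev p ∈ Submodule.span ℝ (Set.range b) := by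
    intro n
    induction n using Nat.strong_induction_on with
    | _ n ih =>
    intro p hp
    rw [p.as_sum, map_sum]
    refine Submodule.sum_mem _ fun a ha => ?_
    have hmon : ∀ (x : S) , ev (monomial a (coeff a p)) x = coeff a p * ∏ i, x.1 i ^ a i := by
      intro x
      rw [hev, eval_monomial, Finsupp.prod_fintype _ _ (by simp)]
    by_cases hlt : ∀ i, a i < m
    · have : ev (monomial a (coeff a p)) = coeff a p • b (fun i => ⟨a i, hlt i⟩) := by
        ext x; rw [hmon]; simp [b]
      rw [this]
      exact Submodule.smul_mem _ _ (Submodule.subset_span ⟨_, rfl⟩)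
    · push Not at hlt
      obtain ⟨i, hi⟩ := hlt
      have hm0 : 0 < m := (Nat.zero_le _).trans_lt (hq i)
      have hdeg : (a.sum fun _ e => e) ≤ n := (le_totalDegree ha).trans hp
      have ha' : a = (a - Finsupp.single i m) + Finsupp.single i m := by
        rw [tsub_add_cancel_of_le]
        exact Finsupp.single_le_iff.2 hi
      set c := a - Finsupp.single i m with hc
      have hsum : (a.sum fun _ e => e) = (c.sum fun _ e => e) + m := by
        conv_lhs => rw [ha']
        rw [Finsupp.sum_add_index' (by simp) (by simp), Finsupp.sum_single_index rfl]
      have : ev (monomial a (coeff a p)) = ev (monomial c (coeff a p) * q i) := by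
        ext x
        rw [hev, hev, map_mul, ← hS x.1 x.2 i]
        conv_lhs => rw [ha', ← mul_one (coeff _ p), ← monomial_mul, map_mul, ← ha']
        congr 1
        simp [eval_monomial]
      rw [this]
      refine ih (n - 1) (by omega) _ ?_
      refine (totalDegree_mul _ _).trans ?_
      have h1 : _ ≤ c.sum fun _ e => e := totalDegree_monomial_le c (coeff a p)
      have h2 := hq i
      omega
  have htop : Submodule.span ℝ (Set.range b) = ⊤ := by
    rw [eq_top_iff]
    intro v _
    choose p hp using crit_interp S
    have : v = ev (∑ x, v x • p x) := by
      ext y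
      rw [hev]
      simp [hp, smul_eval]
    rw [this]
    exact hspan _ _ le_rfl
  have h1 := finrank_range_le_card (R := ℝ) b
  rw [Set.finrank, htop, finrank_top] at h1
  simpa using h1

theorem crit_bound {σ : Type*} [Fintype σ] (f : MvPolynomial σ ℝ) (D : ℕ) (hD : 1 ≤ D)
    (hf : f.totalDegree ≤ D) :
    ((fun x => eval x f) '' {x | ∀ i, eval x (pderiv i f) = 0}).ncard
      ≤ (2 * D - 1) ^ Fintype.card σ := by
  classical
  have hfin := crit_finite f
  set V := (fun x => eval x f) '' {x | ∀ i, eval x (pderiv i f) = 0} with hV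
  have hp : ∀ c ∈ V, ∃ x : σ → ℝ, eval x f = c ∧ ∀ i, eval x (pderiv i f) = 0 := by
    rintro c ⟨x, hx, rfl⟩
    exact ⟨x, rfl, hx⟩
  choose! p hpc hp0 using hp
  -- a separation radius
  obtain ⟨r, hr0, hr⟩ : ∃ r : ℝ, 0 < r ∧ ∀ a ∈ V, ∀ b ∈ V, a ≠ b → 2 * r < |a - b| := by
    have hoff : (V.offDiag).Finite := hfin.offDiag
    have : ∀ᶠ r in nhdsWithin (0:ℝ) (Set.Ioi 0), ∀ q ∈ V.offDiag, 2 * r < |q.1 - q.2| := by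
      rw [Filter.eventually_all_finite hoff]
      intro q hq
      have h0 : 0 < |q.1 - q.2| := abs_pos.2 (sub_ne_zero.2 hq.2.2)
      have : Filter.Tendsto (fun r : ℝ => 2 * r) (nhdsWithin (0:ℝ) (Set.Ioi 0)) (nhds 0) := by
        have : Filter.Tendsto (fun r : ℝ => 2 * r) (nhds 0) (nhds (2 * 0)) :=
          (continuous_const.mul continuous_id).tendsto 0
        rw [mul_zero] at this
        exact this.mono_left nhdsWithin_le_nhds
      exact this.eventually (gt_mem_nhds h0)
    obtain ⟨r, h1, h2⟩ := (this.and self_mem_nhdsWithin).exists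
    exact ⟨r, h2, fun a ha b hb hab => h1 (a, b) ⟨ha, hb, hab⟩⟩
  -- polynomials
  let F : MvPolynomial σ ℝ := ∑ i, (pderiv i f) ^ 2
  let h : MvPolynomial σ ℝ := ∑ i, X i ^ (2 * D)
  have hFev : ∀ x, eval x F = ∑ i, (eval x (pderiv i f)) ^ 2 := fun x => by simp [F]
  have hhev : ∀ x, eval x h = ∑ i, x i ^ (2 * D) := fun x => by simp [h]
  have hF0 : ∀ x, 0 ≤ eval x F := fun x => by
    rw [hFev]; exact Finset.sum_nonneg fun i _ => sq_nonneg _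
  have hh0 : ∀ x, 0 ≤ eval x h := fun x => by
    rw [hhev]; exact Finset.sum_nonneg fun i _ => (even_two_mul D).pow_nonneg _
  have hFz : ∀ x, eval x F = 0 → ∀ i, eval x (pderiv i f) = 0 := fun x hx i => by
    rw [hFev, Finset.sum_eq_zero_iff_of_nonneg fun i _ => sq_nonneg _] at hx
    exact pow_eq_zero_iff (two_ne_zero) |>.1 (hx i (Finset.mem_univ i))
  obtain ⟨H, hH⟩ : ∃ H : ℝ, ∀ c ∈ V, eval (p c) h < H := by
    obtain ⟨M, hM⟩ := (hfin.image fun c => eval (p c) h).bddAbove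
    exact ⟨M + 1, fun c hc => (hM ⟨c, hc, rfl⟩).trans_lt (lt_add_one M)⟩
  have hK : IsCompact {x : σ → ℝ | eval x h ≤ H} := by
    refine Metric.isCompact_of_isClosed_isBounded
      (isClosed_le (continuous_eval h) continuous_const) ?_
    refine (Metric.isBounded_closedBall (x := (0 : σ → ℝ)) (r := max 1 H)).subset fun x hx => ?_
    rw [mem_closedBall_zero_iff, pi_norm_le_iff_of_nonneg (by positivity)]
    intro i
    by_contra! hlt
    have h1 : 1 < |x i| := (le_max_left _ _).trans_lt hlt
    have h2 : H < |x i| := (le_max_right _ _).trans_lt hlt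
    have h3 : |x i| ≤ |x i| ^ (2 * D) := le_self_pow₀ h1.le (by omega)
    rw [(even_two_mul D).pow_abs] at h3
    have h4 : x i ^ (2 * D) ≤ eval x h := by
      rw [hhev]
      exact Finset.single_le_sum (f := fun i => x i ^ (2 * D))
        (fun i _ => (even_two_mul D).pow_nonneg _) (Finset.mem_univ i)
    have hx : eval x h ≤ H := hx
    linarith
  have hcl : ∀ c : ℝ, IsClosed {x : σ → ℝ | |eval x f - c| = r} := fun c =>
    isClosed_eq ((continuous_eval f).sub continuous_const).abs continuous_const
  obtain ⟨m, hm0, hm⟩ : ∃ m : ℝ, 0 < m ∧ ∀ c ∈ V, ∀ x, eval x h ≤ H → |eval x f - c| = r →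
      m ≤ eval x F := by
    let T : Set (σ → ℝ) := {x | eval x h ≤ H} ∩ ⋃ c ∈ V, {x | |eval x f - c| = r}
    have hT : IsCompact T := hK.inter_right (hfin.isClosed_biUnion fun c _ => hcl c)
    by_cases hne : T.Nonempty
    · obtain ⟨y, hy, hmin⟩ := hT.exists_isMinOn hne (continuous_eval F).continuousOn
      refine ⟨eval y F, lt_of_le_of_ne (hF0 y) fun h0 => ?_, fun c hc x h1 h2 =>
        hmin ⟨h1, Set.mem_iUnion₂.2 ⟨c, hc, h2⟩⟩⟩
      have hyV : eval y f ∈ V := ⟨y, hFz y h0.symm, rfl⟩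
      obtain ⟨c, hc, hyc⟩ := Set.mem_iUnion₂.1 hy.2
      have hyc : |eval y f - c| = r := hyc
      have hne : eval y f ≠ c := by
        rintro h
        rw [h, sub_self, abs_zero] at hyc
        exact hr0.ne hyc
      have := hr _ hyV c hc hne
      linarith
    · exact ⟨1, one_pos, fun c hc x h1 h2 => absurd ⟨x, h1, Set.mem_iUnion₂.2 ⟨c, hc, h2⟩⟩ hne⟩
  obtain ⟨δ, hδ0, hδ⟩ : ∃ δ : ℝ, 0 < δ ∧ ∀ c ∈ V, δ * eval (p c) h < m := by
    refine ⟨m / (|H| + 1), by positivity, fun c hc => ?_⟩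
    rw [div_mul_eq_mul_div, div_lt_iff₀ (by positivity)]
    have := hH c hc
    have := le_abs_self H
    nlinarith
  let G : MvPolynomial σ ℝ := F + C δ * h
  have hGev : ∀ x, eval x G = eval x F + δ * eval x h := fun x => by simp [G]
  have hy : ∀ c ∈ V, ∃ y : σ → ℝ, |eval y f - c| < r ∧ ∀ i, eval y (pderiv i G) = 0 := by
    intro c hc
    have hKc : IsCompact ({x : σ → ℝ | eval x h ≤ H} ∩ {x | |eval x f - c| ≤ r}) :=
      hK.inter_right (isClosed_le ((continuous_eval f).sub continuous_const).abs continuous_const)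
    have hpmem : p c ∈ ({x : σ → ℝ | eval x h ≤ H} ∩ {x | |eval x f - c| ≤ r}) := by
      refine ⟨(hH c hc).le, ?_⟩
      simp [hpc c hc, hr0.le]
    obtain ⟨y, ⟨hy1, hy2⟩, hmin⟩ :=
      hKc.exists_isMinOn ⟨_, hpmem⟩ (continuous_eval G).continuousOn
    have hle : eval y G ≤ eval (p c) G := hmin hpmem
    have hFp : eval (p c) F = 0 := by
      rw [hFev]
      exact Finset.sum_eq_zero fun i _ => by rw [hp0 c hc i]; simp
    rw [hGev, hGev, hFp, zero_add] at hle
    have hy1 : eval y h ≤ H := hy1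
    have hy2 : |eval y f - c| ≤ r := hy2
    have hy1' : eval y h < H := by
      have h1 : δ * eval y h ≤ δ * eval (p c) h := by linarith [hF0 y]
      exact (le_of_mul_le_mul_left h1 hδ0).trans_lt (hH c hc)
    have hy2' : |eval y f - c| < r := by
      refine lt_of_le_of_ne hy2 fun he => ?_
      have h1 := hm c hc y hy1 he
      have h2 := hδ c hc
      have h3 := mul_nonneg hδ0.le (hh0 y)
      linarith
    refine ⟨y, hy2', fun i => ?_⟩
    have hloc : IsLocalMin (fun x : σ → ℝ => eval x G) y := by
      have o1 : ∀ᶠ x in nhds y, eval x h < H :=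
        (continuous_eval h).continuousAt.eventually (gt_mem_nhds hy1')
      have o2 : ∀ᶠ x in nhds y, |eval x f - c| < r :=
        ((continuous_eval f).sub continuous_const).abs.continuousAt.eventually (gt_mem_nhds hy2')
      filter_upwards [o1, o2] with x h1 h2
      exact hmin ⟨h1.le, h2.le⟩
    have hcont : ContinuousAt (fun t : ℝ => Function.update y i t) (y i) :=
      (continuous_const.update i continuous_id).continuousAt
    have hloc' : IsLocalMin (fun t : ℝ => eval (Function.update y i t) G) (y i) := by
      have h1 : Filter.Tendsto (fun t : ℝ => Function.update y i t) (nhds (y i)) (nhds y) := by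
        have := hcont.tendsto
        rwa [Function.update_eq_self] at this
      have h2 := h1.eventually hloc
      filter_upwards [h2] with t ht
      simpa using ht
    exact hloc'.hasDerivAt_eq_zero (crit_hasDeriv G i y)
  choose! y hy1 hy2 using hy
  have hinj : Set.InjOn y V := by
    intro a ha b hb hab
    by_contra hne
    have h1 := hr a ha b hb hne
    have h2 := hy1 a ha
    have h3 := hy1 b hb
    rw [hab] at h2
    have : |a - b| ≤ |eval (y b) f - a| + |eval (y b) f - b| := by
      have := abs_sub_le a (eval (y b) f) b
      rwa [abs_sub_comm a (eval (y b) f)] at this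
    linarith
  have hFdeg : F.totalDegree ≤ 2 * (D - 1) := by
    refine totalDegree_finsetSum_le fun i _ => ?_
    refine (totalDegree_pow _ _).trans ?_
    have := crit_pderiv_deg f i
    gcongr
    omega
  have hcount := crit_count (2 * D - 1) (fun i => C (-(δ * (2 * D))⁻¹) * pderiv i F)
    (fun i => by
      refine (totalDegree_mul _ _).trans_lt ?_
      rw [totalDegree_C]
      have := crit_pderiv_deg F i
      omega) (hfin.toFinset.image y) (by
      intro x hx i
      obtain ⟨c, hc, rfl⟩ := Finset.mem_image.1 hx
      have h1 := hy2 c (hfin.mem_toFinset.1 hc) i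
      have h2 : pderiv i h = C (2 * (D : ℝ)) * X i ^ (2 * D - 1) := by
        simp only [h, map_sum, Derivation.leibniz_pow]
        rw [Finset.sum_eq_single i]
        · simp
          exact Or.inl (map_ofNat (C : ℝ →+* MvPolynomial σ ℝ) 2).symm
        · intro b _ hb
          simp [pderiv_X_of_ne hb]
        · simp
      simp only [G, map_add, pderiv_C_mul, h2, map_mul, map_pow, eval_X, eval_C]
        at h1
      simp only [map_mul, eval_C]
      have hD0 : (D : ℝ) ≠ 0 := by positivity
      field_simp
      linarith)
  rw [Finset.card_image_of_injOn (by simpa using hinj)] at hcount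
  rwa [Set.ncard_eq_toFinset_card V hfin]

/-- **Theorem 2.21(1).** If `h₀, h₁, …, h_l` have degree at most `d ≥ 2`, then
the set of values of `h₀` on the KKT variety `V(h̄_KKT)` is finite, with
cardinality at most `c(n+l, d+1, n+l)`. -/
theorem stmt_12 {n l : ℕ} (d : ℕ) (hd : 2 ≤ d)
    (h₀ : MvPolynomial (Fin n) ℝ) (h : Fin l → MvPolynomial (Fin n) ℝ)
    (hdeg₀ : h₀.totalDegree ≤ d) (hdeg : ∀ j, (h j).totalDegree ≤ d) :
    ((fun p => eval p.1 h₀) '' KKTset h₀ h).Finite ∧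
    ((fun p => eval p.1 h₀) '' KKTset h₀ h).ncard ≤ cFun (n + l) (d + 1) (n + l) := by
  classical
  -- the Lagrangian
  let L : MvPolynomial (Fin n ⊕ Fin l) ℝ :=
    rename Sum.inl h₀ - ∑ j, X (Sum.inr j) * rename Sum.inl (h j)
  have hL : L.totalDegree ≤ d + 1 := by
    refine (totalDegree_sub _ _).trans (max_le ?_ ?_)
    · exact (totalDegree_rename_le _ _).trans (by omega)
    · refine totalDegree_finsetSum_le fun j _ => (totalDegree_mul _ _).trans ?_
      have := (totalDegree_rename_le (Sum.inl : Fin n → Fin n ⊕ Fin l) (h j)).trans (hdeg j)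
      rw [totalDegree_X]
      omega
  have hsub : (fun p => eval p.1 h₀) '' KKTset h₀ h ⊆
      (fun x => eval x L) '' {x | ∀ i, eval x (pderiv i L) = 0} := by
    rintro _ ⟨⟨x, lam⟩, ⟨h1, h2⟩, rfl⟩
    have hcomp : (Sum.elim x lam) ∘ Sum.inl = x := by ext; simp
    refine ⟨Sum.elim x lam, ?_, ?_⟩
    · rintro (i | j)
      · have := h2 i
        simp only [L, map_sub, map_sum, Derivation.leibniz, pderiv_rename Sum.inl_injective,
          eval_rename, hcomp, smul_eq_mul, map_add, map_mul, eval_X, Sum.elim_inr, this]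
        simp [pderiv_X_of_ne, hcomp]
      · have hz : ∀ q : MvPolynomial (Fin n) ℝ,
            pderiv (Sum.inr j : Fin n ⊕ Fin l) (rename Sum.inl q) = 0 := by
          intro q
          refine pderiv_eq_zero_of_notMem_vars fun hm => ?_
          have := vars_rename Sum.inl q hm
          simp at this
        simp only [L, map_sub, map_sum, Derivation.leibniz, hz, smul_zero, zero_add, smul_eq_mul,
          map_zero]
        simp [eval_rename, hcomp, h1]
    · simp only [L, map_sub, map_sum, map_mul, eval_rename, hcomp]
      simp [h1]
  have hfin := crit_finite L
  refine ⟨hfin.subset hsub, ?_⟩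
  refine (Set.ncard_le_ncard hsub hfin).trans ((crit_bound L (d + 1) (by omega) hL).trans ?_)
  rw [Fintype.card_sum, Fintype.card_fin, Fintype.card_fin, cFun]
  calc (2 * (d + 1) - 1) ^ (n + l) ≤ 1 * (2 * (d + 1) - 1) ^ (n + l + (n + l) - 1) := by
        rw [one_mul]
        rcases Nat.eq_zero_or_pos (n + l) with h0 | h0
        · rw [h0]
        · exact Nat.pow_le_pow_right (by omega) (by omega)
    _ ≤ _ := Nat.mul_le_mul_right _ (by omega)
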